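/- The map φ : Y → G₁^c × Ω⁽²⁾ defined by φ(x) = (g_x, x̂) satisfies φ ∘ σ_Y = T̄ ∘ φ everywhere on Y, where σ_Y is the transformation induced by σ on Y and T̄ is the transformation induced by the skew product T on G₁^c × Ω⁽²⁾. -/

import Mathlib

open MeasureTheory Filter Set
open scoped ENNReal Classical

noncomputable section

/-- The sequence space `{0,1}^{ℕ*}`; index `n : ℕ` represents the positive integer `n + 1`. -/
abbrev Omega2 : Type := ℕ → Bool

/-- The left shift `(σ x)_n = x_{n+1}`. -/
def shift : Omega2 → Omega2 := fun x n => x (n + 1)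

/-- `x` omits the residue class `a` modulo `q` (the position of index `n` is `n + 1`). -/
def OmitsMod (x : Omega2) (q : ℕ) (a : ZMod q) : Prop :=
  ∀ n : ℕ, ((n + 1 : ℕ) : ZMod q) = a → x n = false

/-- The squarefree flow: sequences whose support omits at least one residue class
modulo `p ^ 2` for every prime `p`. -/
def SqfFlow : Set Omega2 :=
  {x | ∀ p : Nat.Primes, ∃ a : ZMod ((p : ℕ) ^ 2), OmitsMod x ((p : ℕ) ^ 2) a}

instance (p : Nat.Primes) : NeZero ((p : ℕ) ^ 2) := ⟨pow_ne_zero 2 p.2.ne_zero⟩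
instance (n : ℕ) : MeasurableSpace (ZMod n) := ⊤
instance (n : ℕ) : TopologicalSpace (ZMod n) := ⊥
instance (n : ℕ) : DiscreteTopology (ZMod n) := ⟨rfl⟩

/-- The group `G = ∏_p ℤ/p²ℤ`. -/
abbrev G : Type := ∀ p : Nat.Primes, ZMod ((p : ℕ) ^ 2)

/-- Translation by `(-1, -1, -1, …)` on `G`. -/
def T1 : G → G := fun g p => g p - 1

/-- `G₁ = {g : g_p ≡ 1 mod p² for some prime p}`. -/
def G1 : Set G := {g | ∃ p : Nat.Primes, g p = 1}

/-- Shannon entropy of the finite partition of `α` induced by `f`. -/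
def partH {α β : Type*} [MeasurableSpace α] [Fintype β] (μ : Measure α) (f : α → β) : ℝ :=
  ∑ b : β, Real.negMulLog ((μ (f ⁻¹' {b})).toReal)

/-- Entropy of the process generated by the observable `f` under `T`. -/
def procH {α : Type*} [MeasurableSpace α] (μ : Measure α) (T : α → α)
    {k : ℕ} (f : α → Fin k) : ℝ :=
  ⨅ n : ℕ, partH μ (fun x (i : Fin (n + 1)) => f (T^[(i : ℕ)] x)) / (n + 1)

/-- Kolmogorov–Sinai entropy of `T` with respect to `μ`: supremum over finite measurable
partitions (encoded as finite-valued measurable observables). -/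
def ksEntropy {α : Type*} [MeasurableSpace α] (μ : Measure α) (T : α → α) : EReal :=
  ⨆ (k : ℕ) (f : α → Fin k) (_ : Measurable f), ((procH μ T f : ℝ) : EReal)

/-- First return time (`0` if the point never returns). -/
def retTime {α : Type*} (T : α → α) (Y : Set α) (x : α) : ℕ :=
  sInf {n : ℕ | 0 < n ∧ T^[n] x ∈ Y}

/-- Induced (first–return) transformation, as a map of the ambient space. -/
def inducedAmb {α : Type*} (T : α → α) (Y : Set α) (x : α) : α :=
  T^[retTime T Y x] x

/-- Number of omitted residue classes modulo `q`. -/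
def numOmitted (x : Omega2) (q : ℕ) : ℕ := Set.ncard {a : ZMod q | OmitsMod x q a}

/-- `x` is persistent modulo `q`: every residue class meeting the support meets it infinitely. -/
def Persistent (x : Omega2) (q : ℕ) : Prop :=
  ∀ a : ZMod q, (∃ n : ℕ, ((n + 1 : ℕ) : ZMod q) = a ∧ x n = true) →
    {n : ℕ | ((n + 1 : ℕ) : ZMod q) = a ∧ x n = true}.Infinite

/-- The set of `p`-persistent sequences in the squarefree flow. -/
def SP (p : Nat.Primes) : Set Omega2 := {x ∈ SqfFlow | Persistent x ((p : ℕ) ^ 2)}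

/-- `X_I`: sequences omitting exactly `I p` classes mod `p²` and persistent for every `p`. -/
def XI (I : Nat.Primes → ℕ) : Set Omega2 :=
  {x ∈ SqfFlow | (∀ p : Nat.Primes, numOmitted x ((p : ℕ) ^ 2) = I p) ∧
    ∀ p : Nat.Primes, Persistent x ((p : ℕ) ^ 2)}

/-- `X₁ = X_{(1,1,1,…)}`. -/
def X1 : Set Omega2 := XI fun _ => 1

/-- `ρ(x)_p` is the (unique, for `x ∈ X₁`) omitted residue class mod `p²`. -/
def rho (x : Omega2) : G := fun p =>
  if h : ∃ a : ZMod ((p : ℕ) ^ 2), OmitsMod x ((p : ℕ) ^ 2) a then h.choose else 0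

/-- `Y = ρ⁻¹(G₁ᶜ) ⊆ X₁`. -/
def Y : Set Omega2 := {x ∈ X1 | rho x ∈ G1ᶜ}

/-- `α_g(m) = #{1 ≤ n ≤ m : n ≡ g_p mod p² for some prime p}`. -/
def alphaG (g : G) (m : ℕ) : ℕ :=
  Set.ncard {n : ℕ | 1 ≤ n ∧ n ≤ m ∧ ∃ p : Nat.Primes, ((n : ℕ) : ZMod ((p : ℕ) ^ 2)) = g p}

/-- The insertion map `ι : G × Ω⁽²⁾ → X`; position of index `n` is `m = n + 1`, and the
`1`-based value `y_{m - α_g(m)}` is the `0`-based entry `y (n - α_g(n+1))`. -/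
def iota (g : G) (y : Omega2) : Omega2 := fun n =>
  if ∃ p : Nat.Primes, ((n + 1 : ℕ) : ZMod ((p : ℕ) ^ 2)) = g p then false
  else y (n - alphaG g (n + 1))

/-- The skew product `T(g,y) = (T₁ g, σ^{ψ(g)} y)`, `ψ = 1 - 1_{G₁}`. -/
def skewT : G × Omega2 → G × Omega2 := fun gy =>
  if gy.1 ∈ G1 then (T1 gy.1, gy.2) else (T1 gy.1, shift gy.2)

/-- `G₁ᶜ × Ω⁽²⁾` as a subset of `G × Ω⁽²⁾`. -/
def ZSet : Set (G × Omega2) := G1ᶜ ×ˢ (Set.univ : Set Omega2)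

/-- `x̂`: delete from `x` the entries at positions congruent to `(g_x)_p` mod `p²` for some `p`. -/
def hat (x : Omega2) : Omega2 := fun m =>
  x (Nat.nth (fun j => ¬ ∃ p : Nat.Primes, ((j + 1 : ℕ) : ZMod ((p : ℕ) ^ 2)) = rho x p) m)

/-- A Haar probability measure on `G`: a translation-invariant Borel probability measure. -/
def IsHaarLike (m : Measure G) : Prop :=
  IsProbabilityMeasure m ∧ ∀ g : G, MeasurePreserving (fun h => g + h) m m

/-- The `(1/2, 1/2)` Bernoulli measure on `Ω⁽²⁾`, characterized by its cylinder values. -/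
def IsBernoulliHalf (ω : Measure Omega2) : Prop :=
  IsProbabilityMeasure ω ∧
    ∀ (s : Finset ℕ) (v : ℕ → Bool), ω {x | ∀ i ∈ s, x i = v i} = (1 / 2 : ℝ≥0∞) ^ s.card

/-- Normalized restriction of a measure on `G` to `G₁ᶜ`. -/
def mbar (m : Measure G) : Measure G := (m G1ᶜ)⁻¹ • m.restrict G1ᶜ

/-- The `k`-th prime (`0`-indexed), as an element of `Nat.Primes`. -/
def nthPrime (k : ℕ) : Nat.Primes := ⟨Nat.nth Nat.Prime k, Nat.prime_nth_prime k⟩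

/-- `X(r)`: sequences omitting at least one class mod `p_i²` for the first `r` primes. -/
def Xr (r : ℕ) : Set Omega2 :=
  {x | ∀ k : Fin r, ∃ a : ZMod ((nthPrime k : ℕ) ^ 2), OmitsMod x ((nthPrime k : ℕ) ^ 2) a}

/-- `X_I(r)`: elements of `X(r)` omitting exactly `I k` classes mod `p_k²` for `k ≤ r`. -/
def XIr (r : ℕ) (I : Fin r → ℕ) : Set Omega2 :=
  {x ∈ Xr r | ∀ k : Fin r, numOmitted x ((nthPrime k : ℕ) ^ 2) = I k}

/-- Number of distinct words of length `L` occurring in elements of `F`. -/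
def wordCount (F : Set Omega2) (L : ℕ) : ℕ :=
  Set.ncard {w : Fin L → Bool | ∃ x ∈ F, ∃ j : ℕ, ∀ t : Fin L, w t = x (j + (t : ℕ))}

/-- `α_g^r(m)`, counting only the first `r` primes. -/
def alphaGr (r : ℕ) (g : G) (m : ℕ) : ℕ :=
  Set.ncard {n : ℕ | 1 ≤ n ∧ n ≤ m ∧
    ∃ k : Fin r, ((n : ℕ) : ZMod ((nthPrime k : ℕ) ^ 2)) = g (nthPrime k)}

/-- The partial insertion map `ι_r`. -/
def iotaR (r : ℕ) (g : G) (y : Omega2) : Omega2 := fun n =>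
  if ∃ k : Fin r, ((n + 1 : ℕ) : ZMod ((nthPrime k : ℕ) ^ 2)) = g (nthPrime k) then false
  else y (n - alphaGr r g (n + 1))

theorem cast_add_two_eq_iff {q : ℕ} (n : ℕ) (a : ZMod q) :
    ((n + 1 + 1 : ℕ) : ZMod q) = a + 1 ↔ ((n + 1 : ℕ) : ZMod q) = a := by
  rw [Nat.cast_succ (n + 1), add_left_inj]

theorem Persistent.omitsMod_shift_iff {x : Omega2} {q : ℕ} (hx : Persistent x q) (a : ZMod q) :
    OmitsMod (shift x) q a ↔ OmitsMod x q (a + 1) := by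
  refine ⟨fun h n hn => ?_, fun h n hn => h (n + 1) ((cast_add_two_eq_iff n a).2 hn)⟩
  by_contra hxn
  obtain ⟨m, ⟨hm, hxm⟩, hpos⟩ := (hx (a + 1) ⟨n, hn, by simpa using hxn⟩).exists_gt 0
  obtain ⟨k, rfl⟩ := Nat.exists_eq_succ_of_ne_zero hpos.ne'
  exact Bool.false_ne_true ((h k ((cast_add_two_eq_iff k a).1 hm)).symm.trans hxm)

theorem Persistent.shift {x : Omega2} {q : ℕ} (hx : Persistent x q) :
    Persistent (shift x) q := by
  rintro a ⟨n, hn, hxn⟩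
  have hinf := hx (a + 1) ⟨n + 1, (cast_add_two_eq_iff n a).2 hn, hxn⟩
  refine Set.infinite_of_forall_exists_gt fun N => ?_
  obtain ⟨m, ⟨hm, hxm⟩, hlt⟩ := hinf.exists_gt (N + 1)
  obtain ⟨k, rfl⟩ := Nat.exists_eq_succ_of_ne_zero (Nat.ne_zero_of_lt hlt)
  exact ⟨k, ⟨(cast_add_two_eq_iff k a).1 hm, hxm⟩, Nat.lt_of_succ_lt_succ hlt⟩

theorem Persistent.numOmitted_shift {x : Omega2} {q : ℕ} (hx : Persistent x q) :
    numOmitted (_root_.shift x) q = numOmitted x q := by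
  unfold numOmitted
  rw [← Set.ncard_image_of_injective {a | OmitsMod (_root_.shift x) q a}
    (add_left_injective (1 : ZMod q))]
  congr 1
  ext b
  simp only [Set.mem_image, Set.mem_ofPred_eq, hx.omitsMod_shift_iff]
  exact ⟨fun ⟨a, ha, hab⟩ => hab ▸ ha, fun hb => ⟨b - 1, by simpa using hb, by simp⟩⟩

theorem shift_mem_X1 {x : Omega2} (hx : x ∈ X1) : shift x ∈ X1 := by
  obtain ⟨hflow, hnum, hper⟩ := hx
  refine ⟨fun p => ?_, fun p => (hper p).numOmitted_shift.trans (hnum p), fun p => (hper p).shift⟩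
  obtain ⟨a, ha⟩ := hflow p
  exact ⟨a - 1, ((hper p).omitsMod_shift_iff _).2 (by simpa using ha)⟩

theorem omitsMod_rho {x : Omega2} (hx : x ∈ SqfFlow) (p : Nat.Primes) :
    OmitsMod x ((p : ℕ) ^ 2) (rho x p) := by
  unfold rho
  rw [dif_pos (hx p)]
  exact (hx p).choose_spec

theorem omitsMod_iff_eq_rho {x : Omega2} (hx : x ∈ X1) (p : Nat.Primes)
    (a : ZMod ((p : ℕ) ^ 2)) : OmitsMod x ((p : ℕ) ^ 2) a ↔ a = rho x p := by
  refine ⟨fun ha => ?_, fun ha => ha ▸ omitsMod_rho hx.1 p⟩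
  obtain ⟨b, hb⟩ := Set.ncard_eq_one.1 (hx.2.1 p)
  have eq_b {c : ZMod ((p : ℕ) ^ 2)} (hc : OmitsMod x ((p : ℕ) ^ 2) c) : c = b := by
    have : c ∈ {a | OmitsMod x ((p : ℕ) ^ 2) a} := hc
    rwa [hb] at this
  exact (eq_b ha).trans (eq_b (omitsMod_rho hx.1 p)).symm

theorem rho_shift {x : Omega2} (hx : x ∈ X1) : rho (shift x) = T1 (rho x) := by
  funext p
  refine ((omitsMod_iff_eq_rho (shift_mem_X1 hx) p _).1 ?_).symm
  rw [(hx.2.2 p).omitsMod_shift_iff]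
  simpa [T1] using omitsMod_rho hx.1 p

theorem infinite_support {x : Omega2} (hx : x ∈ X1) : {n | x n = true}.Infinite := by
  let p : Nat.Primes := ⟨2, Nat.prime_two⟩
  have : Nontrivial (ZMod ((p : ℕ) ^ 2)) :=
    ZMod.nontrivial_iff.2 (by norm_num [p])
  have hnot : ¬ OmitsMod x ((p : ℕ) ^ 2) (rho x p + 1) := by
    simp [omitsMod_iff_eq_rho hx]
  simp only [OmitsMod, not_forall] at hnot
  obtain ⟨n, hn, hxn⟩ := hnot
  exact (hx.2.2 p _ ⟨n, hn, by simpa using hxn⟩).mono fun _ h => h.2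

theorem Nat.nth_add_ite_eq_nth_succ_add_one (P : ℕ → Prop) (hP : {n | P n}.Infinite) (m : ℕ) :
    Nat.nth P (m + if P 0 then 1 else 0) = Nat.nth (fun n => P (n + 1)) m + 1 := by
  have hinf : {n | P (n + 1)}.Infinite := by
    refine Set.infinite_of_forall_exists_gt fun N => ?_
    obtain ⟨k, hk, hlt⟩ := hP.exists_gt (N + 1)
    obtain ⟨j, rfl⟩ := Nat.exists_eq_succ_of_ne_zero (Nat.ne_zero_of_lt hlt)
    exact ⟨j, hk, Nat.lt_of_succ_lt_succ hlt⟩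
  have hmem : P (Nat.nth (fun n => P (n + 1)) m + 1) := Nat.nth_mem_of_infinite hinf m
  rw [← Nat.nth_count hmem, Nat.count_succ', Nat.count_nth_of_infinite hinf]

theorem hat_shift {x : Omega2} (hx : x ∈ X1) :
    hat (shift x) = if rho x ∈ G1 then hat x else shift (hat x) := by
  set P : ℕ → Prop := fun j =>
    ¬ ∃ p : Nat.Primes, ((j + 1 : ℕ) : ZMod ((p : ℕ) ^ 2)) = rho x p with hPdef
  have hP : {n | P n}.Infinite := by
    refine (infinite_support hx).mono fun n hn ⟨p, hp⟩ => ?_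
    exact Bool.false_ne_true ((omitsMod_rho hx.1 p n hp).symm.trans hn)
  have hP0 : P 0 ↔ rho x ∉ G1 := by
    simp [hPdef, G1, eq_comm]
  have hPsucc : (fun j : ℕ => ¬ ∃ p : Nat.Primes,
      ((j + 1 : ℕ) : ZMod ((p : ℕ) ^ 2)) = rho (shift x) p) = fun j => P (j + 1) := by
    funext j
    simp only [hPdef, rho_shift hx, T1, eq_sub_iff_add_eq, ← Nat.cast_succ, Nat.succ_eq_add_one]
  have hnth (m : ℕ) := Nat.nth_add_ite_eq_nth_succ_add_one P hP m
  have hhat (m : ℕ) : hat (shift x) m = x (Nat.nth (fun j => P (j + 1)) m + 1) := by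
    rw [← hPsucc]
    rfl
  funext m
  rw [hhat, ← hnth]
  by_cases h : rho x ∈ G1
  · rw [if_pos h, if_neg (fun h0 => hP0.1 h0 h)]
    rfl
  · rw [if_neg h, if_pos (hP0.2 h)]
    rfl

theorem skewT_rho_hat {x : Omega2} (hx : x ∈ X1) :
    skewT (rho x, hat x) = (rho (shift x), hat (shift x)) := by
  rw [rho_shift hx, hat_shift hx]
  unfold skewT
  split_ifs <;> rfl

theorem shift_iterate_mem_X1 {x : Omega2} (hx : x ∈ X1) (n : ℕ) : shift^[n] x ∈ X1 :=
  Set.MapsTo.iterate (fun _ => shift_mem_X1) n hx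

theorem skewT_iterate_rho_hat {x : Omega2} (hx : x ∈ X1) (n : ℕ) :
    skewT^[n] (rho x, hat x) = (rho (shift^[n] x), hat (shift^[n] x)) := by
  induction n with
  | zero => rfl
  | succ n ih =>
    rw [Function.iterate_succ_apply', ih, skewT_rho_hat (shift_iterate_mem_X1 hx n),
      Function.iterate_succ_apply']

theorem retTime_skewT {x : Omega2} (hx : x ∈ X1) :
    retTime skewT ZSet (rho x, hat x) = retTime shift Y x := by
  unfold retTime
  congr 1
  ext n
  simp [skewT_iterate_rho_hat hx, ZSet, Y, shift_iterate_mem_X1 hx n]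

/-- The map `φ : Y → G₁ᶜ × Ω⁽²⁾`, `φ(x) = (g_x, x̂)`, satisfies
`φ ∘ σ_Y = T̄ ∘ φ` everywhere on `Y`, where `σ_Y` is the transformation induced by the
shift on `Y` and `T̄` the transformation induced by the skew product `T` on `G₁ᶜ × Ω⁽²⁾`. -/
theorem phi_intertwines : ∀ x ∈ Y,
    (rho (inducedAmb shift Y x), hat (inducedAmb shift Y x)) =
      inducedAmb skewT ZSet (rho x, hat x) := by
  intro x hx
  unfold inducedAmb
  rw [retTime_skewT hx.1, skewT_iterate_rho_hat hx.1]

end
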